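/- Let n ≥ 2 and let H : ℙ^n ⇢ ℙ^n be a birational map that maps every projective line not contained in its indeterminacy locus birationally onto a projective line. Then H is a biholomorphism of ℙ^n, i.e., H is induced by an element of PGL(n+1, ℂ). -/

import Mathlib

open Module

open MvPolynomial in
/-- The substitution `X i ↦ X i * T` separates the homogeneous components. -/
theorem MvPolynomial.coeff_aeval_C_X_mul_X {σ R : Type*} [CommSemiring R]
    (p : MvPolynomial σ R) (k : ℕ) :
    (aeval (fun i => Polynomial.C (X i : MvPolynomial σ R) * Polynomial.X) p).coeff k =
      homogeneousComponent k p := by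
  induction p using MvPolynomial.induction_on' with
  | monomial m a =>
    rw [aeval_monomial, Finsupp.prod]
    simp only [mul_pow, Finset.prod_mul_distrib, Finset.prod_pow_eq_pow_sum, ← map_pow, ← map_prod]
    rw [← mul_assoc, IsScalarTower.algebraMap_apply R (MvPolynomial σ R) _,
      Polynomial.algebraMap_eq, ← map_mul, Polynomial.coeff_C_mul_X_pow, algebraMap_eq]
    rw [homogeneousComponent_of_mem (isHomogeneous_monomial a rfl)]
    rw [monomial_eq]
    rfl
  | add p q hp hq => simp [hp, hq]

open MvPolynomial in
theorem MvPolynomial.IsHomogeneous.exists_of_mul {σ R : Type*} [CommRing R] [IsDomain R]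
    {p q : MvPolynomial σ R} {d : ℕ} (h : (p * q).IsHomogeneous d) (hpq : p * q ≠ 0) :
    ∃ a b, a + b = d ∧ p.IsHomogeneous a ∧ q.IsHomogeneous b := by
  set Ψ := MvPolynomial.aeval (R := R) (fun i => Polynomial.C (X i : MvPolynomial σ R) * Polynomial.X) with hΨ
  have hmono : Ψ (p * q) = Polynomial.monomial d (p * q) := by
    ext1 k
    rw [hΨ, coeff_aeval_C_X_mul_X, homogeneousComponent_of_mem h, Polynomial.coeff_monomial]
    simp only [eq_comm]
  have h0 : Ψ p * Ψ q ≠ 0 := by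
    rw [← map_mul, hmono]; simpa using hpq
  have hp0 := left_ne_zero_of_mul h0
  have hq0 := right_ne_zero_of_mul h0
  have h1 := Polynomial.natDegree_mul hp0 hq0
  have h2 := Polynomial.natTrailingDegree_mul hp0 hq0
  rw [← map_mul, hmono, Polynomial.natDegree_monomial_eq _ hpq] at h1
  rw [← map_mul, hmono, Polynomial.natTrailingDegree_monomial hpq] at h2
  have h3 := Polynomial.natTrailingDegree_le_natDegree (Ψ p)
  have h4 := Polynomial.natTrailingDegree_le_natDegree (Ψ q)
  have key : ∀ r : MvPolynomial σ R,
      (Ψ r).natTrailingDegree = (Ψ r).natDegree → r.IsHomogeneous (Ψ r).natDegree := by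
    intro r hr
    have hc : ∀ k, k ≠ (Ψ r).natDegree → homogeneousComponent k r = 0 := by
      intro k hk
      rw [← coeff_aeval_C_X_mul_X]
      rcases lt_or_gt_of_ne hk with hk | hk
      · exact Polynomial.coeff_eq_zero_of_lt_natTrailingDegree (hr ▸ hk)
      · exact Polynomial.coeff_eq_zero_of_natDegree_lt hk
    intro m hm
    by_contra hne
    have := congrArg (coeff m) (hc m.degree (by rwa [Finsupp.degree_eq_weight_one]))
    rw [coeff_homogeneousComponent, if_pos rfl, coeff_zero] at this
    exact hm this
  exact ⟨_, _, h1.symm, key p (by omega), key q (by omega)⟩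

theorem MvPolynomial.IsHomogeneous.eval_smul {σ R : Type*} [CommSemiring R]
    {p : MvPolynomial σ R} {d : ℕ} (h : p.IsHomogeneous d) (c : R) (x : σ → R) :
    MvPolynomial.eval (c • x) p = c ^ d * MvPolynomial.eval x p := by
  simp only [MvPolynomial.eval_eq, Finset.mul_sum]
  refine Finset.sum_congr rfl fun m hm => ?_
  have : ∑ i ∈ m.support, m i = d := h.degree_eq_sum_deg_support hm ▸ rfl
  simp only [Pi.smul_apply, smul_eq_mul, mul_pow, Finset.prod_mul_distrib,
    Finset.prod_pow_eq_pow_sum, this]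
  ring

theorem exists_eq_mul_of_forall_dvd_isUnit {R ι : Type*} [CommRing R] [IsDomain R]
    [UniqueFactorizationMonoid R] [Fintype ι] [Nonempty ι] (F : ι → R) :
    ∃ (p : R) (F' : ι → R), (∀ i, F i = p * F' i) ∧
      ∀ g, (∀ i, g ∣ F' i) → IsUnit g := by
  classical
  obtain ⟨_⟩ : Nonempty (NormalizedGCDMonoid R) := inferInstance
  obtain ⟨F', h1, h2⟩ := Finset.extract_gcd F (s := Finset.univ) Finset.univ_nonempty
  refine ⟨_, F', fun i => h1 i (Finset.mem_univ i), fun g hg => ?_⟩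
  exact isUnit_of_dvd_one (h2 ▸ Finset.dvd_gcd fun i _ => hg i)

open Polynomial in
theorem Polynomial.exists_C_mem_span_of_forall_dvd_isUnit {R ι : Type*} [CommRing R] [IsDomain R]
    [UniqueFactorizationMonoid R] (P : ι → R[X])
    (hP : ∀ g, (∀ i, g ∣ P i) → IsUnit g) :
    ∃ r : R, r ≠ 0 ∧ C r ∈ Ideal.span (Set.range P) := by
  classical
  obtain ⟨_⟩ : Nonempty (NormalizedGCDMonoid R) := inferInstance
  let K := FractionRing R
  let := Polynomial.algebra R K
  have := Polynomial.isLocalization (nonZeroDivisors R) K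
  by_contra! hcon
  have hdisj : Disjoint (((nonZeroDivisors R).map (C : R →+* R[X]) : Submonoid R[X]) : Set R[X])
      (Ideal.span (Set.range P) : Set R[X]) := by
    rw [Set.disjoint_left]
    rintro _ ⟨r, hr, rfl⟩
    exact hcon r (nonZeroDivisors.ne_zero hr)
  rw [← IsLocalization.map_algebraMap_ne_top_iff_disjoint _ K[X]] at hdisj
  obtain ⟨g, hg⟩ := IsPrincipalIdealRing.principal
    ((Ideal.span (Set.range P)).map (algebraMap R[X] K[X]))
  rw [Ideal.submodule_span_eq] at hg
  have hgP : ∀ i, g ∣ (P i).map (algebraMap R K) := by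
    intro i
    rw [← Ideal.mem_span_singleton, ← hg]
    exact Ideal.mem_map_of_mem (algebraMap R[X] K[X]) (Ideal.subset_span ⟨i, rfl⟩)
  have hgu : ¬ IsUnit g := by
    rwa [hg, Ne, Ideal.span_singleton_eq_top] at hdisj
  obtain ⟨b, hb, hb'⟩ := IsLocalization.integerNormalization_spec (nonZeroDivisors R) g
  set N := IsLocalization.integerNormalization (nonZeroDivisors R) g
  by_cases hg0 : g = 0
  · have hX : IsUnit (X : R[X]) := hP X fun i => by
      have := hgP i
      rw [hg0, zero_dvd_iff, Polynomial.map_eq_zero_iff (IsFractionRing.injective R K)] at this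
      simp [this]
    exact Polynomial.not_isUnit_X hX
  have hdvd : ∀ i, N.primPart ∣ P i := by
    intro i
    refine N.isPrimitive_primPart.dvd_of_fraction_map_dvd_fraction_map (K := K) ?_
    have hmap : N.map (algebraMap R K) = C (algebraMap R K b) * g := by
      rw [hb', ← IsScalarTower.algebraMap_smul K b g, Polynomial.smul_eq_C_mul]
    have hunit : IsUnit (C (algebraMap R K b)) := Polynomial.isUnit_C.2 <| IsUnit.mk0 _ <|
      (map_ne_zero_iff _ (IsFractionRing.injective R K)).2 (nonZeroDivisors.ne_zero hb)
    have hdvdN : N.primPart.map (algebraMap R K) ∣ C (algebraMap R K b) * g :=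
      hmap ▸ Polynomial.map_dvd _ N.primPart_dvd
    exact ((hunit.dvd_mul_left).1 hdvdN).trans (hgP i)
  exact hgu ((isUnit_or_eq_zero_of_isUnit_integerNormalization_primPart hg0
    (hP _ hdvd)))

theorem MvPolynomial.eval_aeval_toMvPolynomial {m R : Type*} [Fintype m] [DecidableEq m]
    [CommRing R] (B : (m → R) →ₗ[R] (m → R)) (p : MvPolynomial m R) (x : m → R) :
    eval x (aeval (LinearMap.toMatrix' B).toMvPolynomial p) = eval (B x) p := by
  have h : (fun i => eval x ((LinearMap.toMatrix' B).toMvPolynomial i)) = B x := by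
    ext i
    rw [Matrix.toMvPolynomial_eval_eq_apply, LinearMap.toMatrix'_mulVec]
  rw [← h]
  simpa [aeval_eq_bind₁, eval₂_id] using
    eval₂Hom_bind₁ (RingHom.id R) x (LinearMap.toMatrix' B).toMvPolynomial p

/-- A family without common factor has no common zero on a general line of given direction,
away from the point at infinity. -/
theorem MvPolynomial.exists_line_forall_exists_eval_ne_zero {n : ℕ} (hn : 0 < n) {ι : Type*}
    (P : ι → MvPolynomial (Fin (n + 1)) ℂ) (hP : ∀ g, (∀ i, g ∣ P i) → IsUnit g)
    {v : Fin (n + 1) → ℂ} (hv : v ≠ 0) :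
    ∃ x : Fin (n + 1) → ℂ, LinearIndependent ℂ ![v, x] ∧
      ∀ t : ℂ, ∃ i, eval (x + t • v) (P i) ≠ 0 := by
  obtain ⟨B, hB⟩ := SeparatingDual.exists_continuousLinearEquiv_apply_eq (R := ℂ)
    (x := (Fin.cons 1 0 : Fin (n + 1) → ℂ)) (y := v)
    (fun h => one_ne_zero (congrFun h 0)) hv
  set φ := aeval (R := ℂ) (LinearMap.toMatrix' B.toLinearEquiv.toLinearMap).toMvPolynomial
    with hφ
  set ψ := aeval (R := ℂ)
    (LinearMap.toMatrix' B.symm.toLinearEquiv.toLinearMap).toMvPolynomial with hψ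
  have hφψ : ∀ p, φ (ψ p) = p := fun p => MvPolynomial.funext fun x => by
    rw [hφ, hψ, eval_aeval_toMvPolynomial, eval_aeval_toMvPolynomial]
    simp
  have hψφ : ∀ p, ψ (φ p) = p := fun p => MvPolynomial.funext fun x => by
    rw [hφ, hψ, eval_aeval_toMvPolynomial, eval_aeval_toMvPolynomial]
    simp
  obtain ⟨r, hr0, hr⟩ := Polynomial.exists_C_mem_span_of_forall_dvd_isUnit
    (fun i => finSuccEquiv ℂ n (φ (P i))) (by
      intro g hg
      have h1 : IsUnit (ψ ((finSuccEquiv ℂ n).symm g)) := hP _ fun i => by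
        have := map_dvd ψ (map_dvd (finSuccEquiv ℂ n).symm (hg i))
        simpa [hψφ] using this
      have h2 := (h1.map φ).map (finSuccEquiv ℂ n)
      simpa [hφψ] using h2)
  let i₀ : Fin n := ⟨0, hn⟩
  obtain ⟨y, hy⟩ : ∃ y, eval y (r * X i₀) ≠ 0 := by
    by_contra! h
    exact mul_ne_zero hr0 (X_ne_zero i₀) (MvPolynomial.funext fun y => by simpa using h y)
  rw [map_mul, eval_X] at hy
  refine ⟨B (Fin.cons 0 y), ?_, fun t => ?_⟩
  · rw [LinearIndependent.pair_iff' hv]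
    intro a ha
    rw [← hB, ← map_smul] at ha
    have := congrFun (B.injective ha) i₀.succ
    simp only [Pi.smul_apply, Fin.cons_succ, Pi.zero_apply, smul_zero] at this
    exact right_ne_zero_of_mul hy this.symm
  · by_contra! h
    have hle : Ideal.span (Set.range fun i => finSuccEquiv ℂ n (φ (P i))) ≤
        RingHom.ker ((Polynomial.evalRingHom t).comp (Polynomial.mapRingHom (eval y))) := by
      rw [Ideal.span_le]
      rintro _ ⟨i, rfl⟩
      have h3 : B (Fin.cons 0 y) + t • v = B (Fin.cons t y) := by
        rw [← hB, ← map_smul, ← map_add]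
        congr 1
        ext j
        refine Fin.cases ?_ (fun j => ?_) j <;> simp
      have h4 := h i
      rw [h3] at h4
      simp only [SetLike.mem_coe, RingHom.mem_ker, RingHom.comp_apply, Polynomial.coe_mapRingHom,
        Polynomial.coe_evalRingHom]
      rw [← eval_eq_eval_mv_eval', hφ, eval_aeval_toMvPolynomial]
      exact h4
    have := hle hr
    simp only [RingHom.mem_ker, RingHom.comp_apply, Polynomial.coe_mapRingHom,
        Polynomial.coe_evalRingHom, Polynomial.map_C, Polynomial.eval_C] at this
    exact left_ne_zero_of_mul hy this

open Polynomial in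
theorem Polynomial.natDegree_le_one_of_unique_simple_root {m : ℂ[X]} {t₀ : ℂ}
    (huniq : ∀ t, m.eval t = 0 → t = t₀) (hder : m.derivative.eval t₀ ≠ 0) :
    m.natDegree ≤ 1 := by
  have hm : m ≠ 0 := by rintro rfl; simp at hder
  rw [(IsAlgClosed.splits m).natDegree_eq_card_roots]
  have h1 : m.roots = Multiset.replicate (Multiset.card m.roots) t₀ :=
    Multiset.eq_replicate_card.2 fun t ht => huniq t ((mem_roots hm).1 ht)
  have h2 : m.roots.count t₀ = Multiset.card m.roots := by
    conv_lhs => rw [h1]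
    exact Multiset.count_replicate_self _ _
  by_contra! hlt
  rw [← h2, count_roots, one_lt_rootMultiplicity_iff_isRoot hm] at hlt
  exact hder hlt.2

open Polynomial in
/-- A generically injective map `t ↦ [α t : β t]` given by coprime polynomials has degree at
most one. -/
theorem Polynomial.natDegree_le_one_of_generically_injective {α β : ℂ[X]} (h : IsCoprime α β)
    {T : Set ℂ} (hT : T.Finite)
    (hinj : ∀ t ∉ T, ∀ s ∉ T, α.eval t * β.eval s = α.eval s * β.eval t → t = s) :
    α.natDegree ≤ 1 ∧ β.natDegree ≤ 1 := by
  have hne : ∀ s, α.eval s ≠ 0 ∨ β.eval s ≠ 0 := fun s => by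
    simpa using (isCoprime_iff_aeval_ne_zero_of_isAlgClosed ℂ ℂ α β).1 h s
  by_cases hW : derivative α * β = α * derivative β
  · have key : ∀ γ δ : ℂ[X], IsCoprime γ δ → derivative γ * δ = γ * derivative δ →
        γ.natDegree = 0 := by
      intro γ δ hc hw
      have h1 : γ ∣ derivative γ := hc.dvd_of_dvd_mul_right ⟨_, hw⟩
      by_contra h0
      have h2 := natDegree_derivative_lt h0
      have h3 : derivative γ = 0 := eq_zero_of_dvd_of_natDegree_lt h1 h2
      exact h0 (derivative_eq_zero.1 h3)
    exact ⟨(key α β h hW).le.trans zero_le_one,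
      (key β α h.symm (by linear_combination -hW)).le.trans zero_le_one⟩
  set T' : Set ℂ := ⋃ s ∈ T, {t | t ∉ T ∧ α.eval t * β.eval s = α.eval s * β.eval t}
  have hT' : T'.Finite := by
    refine hT.biUnion fun s _ => Set.Subsingleton.finite ?_
    rintro a ⟨ha, ha'⟩ b ⟨hb, hb'⟩
    refine hinj a ha b hb ?_
    rcases hne s with hs | hs
    · refine mul_left_cancel₀ hs ?_
      linear_combination -α.eval a * hb' + α.eval b * ha'
    · refine mul_left_cancel₀ hs ?_
      linear_combination β.eval b * ha' - β.eval a * hb'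
  set W := derivative α * β - α * derivative β
  have hW0 : W ≠ 0 := sub_ne_zero.2 hW
  have hU : (T ∪ T' ∪ {t | W.IsRoot t}).Finite :=
    (hT.union hT').union (finite_setOfPred_isRoot hW0)
  have hdeg : ∀ t₀ ∉ T ∪ T' ∪ {t | W.IsRoot t},
      (C (β.eval t₀) * α - C (α.eval t₀) * β).natDegree ≤ 1 := by
    intro t₀ ht₀
    simp only [Set.mem_union, not_or] at ht₀
    obtain ⟨⟨h1, h2⟩, h3⟩ := ht₀
    refine natDegree_le_one_of_unique_simple_root (t₀ := t₀) (fun t ht => ?_) ?_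
    · simp only [eval_sub, eval_mul, eval_C] at ht
      by_cases htT : t ∈ T
      · have h4 : α.eval t₀ * β.eval t = α.eval t * β.eval t₀ := by linear_combination -ht
        exact (h2 (Set.mem_iUnion₂.2 ⟨t, htT, h1, h4⟩)).elim
      · exact hinj t htT t₀ h1 (by linear_combination ht)
    · intro h4
      apply h3
      simp only [derivative_sub, derivative_mul, derivative_C, eval_sub, eval_mul, eval_C,
        zero_mul, zero_add] at h4
      simp only [Set.mem_ofPred_eq, IsRoot.def, W, eval_sub, eval_mul]
      linear_combination h4
  have hcoeff : ∀ k, 1 < k → C (α.coeff k) * β = C (β.coeff k) * α := by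
    intro k hk
    refine eq_of_infinite_eval_eq _ _ (hU.infinite_compl.mono fun t ht => ?_)
    have := coeff_eq_zero_of_natDegree_lt ((hdeg t ht).trans_lt hk)
    simp only [coeff_sub, coeff_C_mul] at this
    simp only [Set.mem_ofPred_eq, eval_mul, eval_C]
    linear_combination this
  have key : ∀ γ δ : ℂ[X], IsCoprime γ δ →
      (∀ k, 1 < k → C (γ.coeff k) * δ = C (δ.coeff k) * γ) → γ.natDegree ≤ 1 := by
    intro γ δ hc hk
    by_contra! hlt
    have h1 : γ ∣ C (γ.coeff γ.natDegree) :=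
      hc.dvd_of_dvd_mul_right ⟨C (δ.coeff γ.natDegree), by rw [hk _ hlt, mul_comm]⟩
    have h0 : γ ≠ 0 := by rintro rfl; simp at hlt
    have h2 := natDegree_le_of_dvd h1 (by simpa using h0)
    rw [natDegree_C] at h2
    omega
  exact ⟨key α β h hcoeff, key β α h.symm fun k hk => (hcoeff k hk).symm⟩

open Polynomial in
/-- A polynomial curve without zeros, contained in a plane and generically injective into the
projectivization, is affine. -/
theorem Polynomial.natDegree_le_one_of_mem_plane {ι : Type*} [Fintype ι] {f : ι → ℂ[X]}
    (hf : ∀ t, ∃ i, (f i).eval t ≠ 0) {L : Submodule ℂ (ι → ℂ)} (hL : finrank ℂ L = 2)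
    {T : Set ℂ} (hT : T.Finite) (hmem : ∀ t ∉ T, (fun i => (f i).eval t) ∈ L)
    (hinj : ∀ t ∉ T, ∀ s ∉ T,
      Submodule.span ℂ {fun i => (f i).eval t} = Submodule.span ℂ {fun i => (f i).eval s} → t = s)
    (i : ι) : (f i).natDegree ≤ 1 := by
  classical
  let b := finBasisOfFinrankEq ℂ L hL
  obtain ⟨P, hP⟩ := LinearMap.exists_leftInverse_of_injective L.subtype (by simp)
  let α : Fin 2 → ℂ[X] := fun k => ∑ i, C (b.coord k (P fun j => if i = j then 1 else 0)) * f i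
  have hα : ∀ k t, (α k).eval t = b.coord k (P fun i => (f i).eval t) := by
    intro k t
    rw [← LinearMap.comp_apply, LinearMap.pi_apply_eq_sum_univ]
    simp [α, eval_finsetSum, mul_comm]
  have hfα : ∀ i, f i = α 0 * C ((b 0 : ι → ℂ) i) + α 1 * C ((b 1 : ι → ℂ) i) := by
    intro i
    refine eq_of_infinite_eval_eq _ _ (hT.infinite_compl.mono fun t ht => ?_)
    have h1 := LinearMap.congr_fun hP ⟨_, hmem t ht⟩
    simp only [LinearMap.comp_apply, Submodule.subtype_apply, LinearMap.id_apply] at h1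
    have h2 := b.sum_repr ⟨_, hmem t ht⟩
    rw [Fin.sum_univ_two] at h2
    have h3 := congrFun (congrArg Subtype.val h2) i
    simp only [Set.mem_ofPred_eq, eval_add, eval_mul, eval_C, hα, h1]
    simpa using h3.symm
  have hco : IsCoprime (α 0) (α 1) := by
    rw [isCoprime_iff_aeval_ne_zero_of_isAlgClosed ℂ ℂ]
    intro t
    by_contra! h0
    obtain ⟨i, hi⟩ := hf t
    simp only [coe_aeval_eq_eval] at h0
    apply hi
    rw [hfα]
    simp [h0.1, h0.2]
  have hpar : ∀ c d t s : ℂ, c • (fun i => (f i).eval t) = d • (fun i => (f i).eval s) → c ≠ 0 →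
      Submodule.span ℂ {fun i => (f i).eval t} = Submodule.span ℂ {fun i => (f i).eval s} := by
    intro c d t s h1 hc
    have hd : d ≠ 0 := by
      rintro rfl
      obtain ⟨i, hi⟩ := hf t
      have := congrFun h1 i
      simp [hc, hi] at this
    rw [← Submodule.span_singleton_smul_eq (IsUnit.mk0 c hc), h1,
      Submodule.span_singleton_smul_eq (IsUnit.mk0 d hd)]
  obtain ⟨h0, h1⟩ := natDegree_le_one_of_generically_injective hco hT fun t ht s hs hts => by
    refine hinj t ht s hs ?_
    have hne := (isCoprime_iff_aeval_ne_zero_of_isAlgClosed ℂ ℂ _ _).1 hco s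
    simp only [coe_aeval_eq_eval] at hne
    rcases hne with hne | hne
    · refine hpar ((α 0).eval s) ((α 0).eval t) t s ?_ hne
      ext i
      simp only [Pi.smul_apply, smul_eq_mul, hfα i, eval_add, eval_mul, eval_C]
      linear_combination -((b 1 : ι → ℂ) i) * hts
    · refine hpar ((α 1).eval s) ((α 1).eval t) t s ?_ hne
      ext i
      simp only [Pi.smul_apply, smul_eq_mul, hfα i, eval_add, eval_mul, eval_C]
      linear_combination ((b 0 : ι → ℂ) i) * hts
  rw [hfα i]
  exact natDegree_add_le_of_degree_le ((natDegree_mul_C_le _ _).trans h0)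
    ((natDegree_mul_C_le _ _).trans h1)

theorem MvPolynomial.exists_polynomial_eval_line {σ R : Type*} [CommSemiring R]
    (P : MvPolynomial σ R) (x v : σ → R) :
    ∃ f : Polynomial R, ∀ t, f.eval t = eval (x + t • v) P := by
  refine ⟨aeval (fun i => Polynomial.C (x i) + Polynomial.X * Polynomial.C (v i)) P, fun t => ?_⟩
  rw [← Polynomial.coe_evalRingHom, ← eval₂_id, aeval_def, hom_eval₂]
  congr 1
  · ext; simp
  · ext; simp [mul_comm t]

/-- If a form restricts to an affine function `t ↦ a + t * b` on a line whose point at infinity is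
not a zero of the form, then the form has degree at most one and does not vanish on the line. -/
theorem MvPolynomial.IsHomogeneous.le_one_of_eval_line {σ : Type*} {P : MvPolynomial σ ℂ} {d : ℕ}
    (hP : P.IsHomogeneous d) {x v : σ → ℂ} (hv : eval v P ≠ 0) {a b : ℂ}
    (h : ∀ t : ℂ, eval (x + t • v) P = a + t * b) : d ≤ 1 ∧ (a ≠ 0 ∨ b ≠ 0) := by
  obtain ⟨g, hg⟩ := exists_polynomial_eval_line P v x
  have hg0 : g.eval 0 ≠ 0 := by simpa [hg] using hv
  have hpoly : g * Polynomial.X =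
      Polynomial.X ^ d * (Polynomial.C a * Polynomial.X + Polynomial.C b) := by
    refine Polynomial.eq_of_infinite_eval_eq _ _
      ((Set.finite_singleton (0 : ℂ)).infinite_compl.mono fun s hs => ?_)
    have hs : s ≠ 0 := by simpa using hs
    have h1 : v + s • x = s • (x + s⁻¹ • v) := by
      rw [smul_add, smul_smul, mul_inv_cancel₀ hs, one_smul, add_comm]
    simp only [Set.mem_ofPred_eq, Polynomial.eval_mul, Polynomial.eval_X, Polynomial.eval_pow,
      Polynomial.eval_add, Polynomial.eval_C, hg, h1, hP.eval_smul, h]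
    field_simp
  refine ⟨?_, ?_⟩
  · by_contra! hd
    obtain ⟨k, rfl⟩ := Nat.exists_eq_add_of_le' hd
    have : g = Polynomial.X ^ (k + 1) * (Polynomial.C a * Polynomial.X + Polynomial.C b) :=
      mul_right_cancel₀ Polynomial.X_ne_zero (by rw [hpoly, Nat.succ_eq_add_one]; ring)
    exact hg0 (by simp [this])
  · by_contra! hab
    rw [hab.1, hab.2] at hpoly
    have : g = 0 := by simpa using hpoly
    exact hg0 (by simp [this])

theorem MvPolynomial.IsHomogeneous.isLinearMap_eval {σ R : Type*} [CommSemiring R]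
    {P : MvPolynomial σ R} (hP : P.IsHomogeneous 1) : IsLinearMap R fun x => eval x P := by
  have h : P ∈ Submodule.span R (Set.range X) := by
    rw [← homogeneousSubmodule_one_eq_span_X]; exact hP
  clear hP
  induction h using Submodule.span_induction with
  | mem p hp =>
    obtain ⟨i, rfl⟩ := hp
    exact ⟨by simp, by simp⟩
  | zero => exact ⟨by simp, by simp⟩
  | add p q _ _ hp hq =>
    exact ⟨fun x y => by simp only [map_add, hp.map_add, hq.map_add]; abel,
      fun c x => by simp only [map_add, hp.map_smul, hq.map_smul, smul_add]⟩
  | smul a p _ hp =>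
    exact ⟨fun x y => by simp only [smul_eval, hp.map_add, mul_add],
      fun c x => by simp only [smul_eval, hp.map_smul, smul_eq_mul]; ring⟩

theorem MvPolynomial.exists_eval_ne_zero {σ R : Type*} [CommRing R] [IsDomain R] [Infinite R]
    {P : MvPolynomial σ R} (hP : P ≠ 0) : ∃ x, eval x P ≠ 0 := by
  by_contra! h
  exact hP (MvPolynomial.funext fun x => by simpa using h x)

theorem MvPolynomial.exists_eval_ne_zero_and_ne_smul {n : ℕ} (hn : 0 < n)
    {h : MvPolynomial (Fin (n + 1)) ℂ} (hh : h ≠ 0) (w : Fin (n + 1) → ℂ) :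
    ∃ x, eval x h ≠ 0 ∧ ∀ c : ℂ, x ≠ c • w := by
  obtain ⟨l, hl0, hl⟩ : ∃ l : MvPolynomial (Fin (n + 1)) ℂ, l ≠ 0 ∧
      ∀ c : ℂ, eval (c • w) l = 0 := by
    by_cases hw : w 0 = 0
    · exact ⟨X 0, X_ne_zero 0, fun c => by simp [hw]⟩
    · let j : Fin (n + 1) := Fin.succ ⟨0, hn⟩
      refine ⟨C (w 0) * X j - C (w j) * X 0, fun h0 => hw ?_, fun c => by simp; ring⟩
      have := congrArg (eval (Pi.single j 1)) h0
      simpa [j] using this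
  obtain ⟨x, hx⟩ := exists_eval_ne_zero (mul_ne_zero hh hl0)
  rw [map_mul] at hx
  exact ⟨x, left_ne_zero_of_mul hx, fun c hc => right_ne_zero_of_mul hx (hc ▸ hl c)⟩

/-- After removing the common factor, a nonzero family of forms of the same degree is still such a
family. -/
theorem MvPolynomial.exists_isHomogeneous_eq_mul {σ ι : Type*} [Finite σ] [Fintype ι]
    {F : ι → MvPolynomial σ ℂ} {d : ℕ} (hF : ∀ i, (F i).IsHomogeneous d) {i₀ : ι}
    (hi₀ : F i₀ ≠ 0) :
    ∃ (p : MvPolynomial σ ℂ) (F' : ι → MvPolynomial σ ℂ) (a b : ℕ), (∀ i, F i = p * F' i) ∧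
      p.IsHomogeneous a ∧ (∀ i, (F' i).IsHomogeneous b) ∧
      ∀ g, (∀ i, g ∣ F' i) → IsUnit g := by
  have : Nonempty ι := ⟨i₀⟩
  obtain ⟨p, F', hpF, hg⟩ := exists_eq_mul_of_forall_dvd_isUnit F
  have hp0 : p ≠ 0 := fun h => hi₀ (by rw [hpF, h, zero_mul])
  obtain ⟨a, b, hab, ha, -⟩ := IsHomogeneous.exists_of_mul (hpF i₀ ▸ hF i₀) (hpF i₀ ▸ hi₀)
  refine ⟨p, F', a, b, hpF, ha, fun i => ?_, hg⟩
  by_cases hi : F i = 0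
  · have : F' i = 0 := by
      have := hpF i
      rw [hi, eq_comm, mul_eq_zero] at this
      exact this.resolve_left hp0
    rw [this]
    exact isHomogeneous_zero _ _ _
  · obtain ⟨a', b', hab', ha', hb'⟩ := IsHomogeneous.exists_of_mul (hpF i ▸ hF i) (hpF i ▸ hi)
    have := ha.inj_right ha' hp0
    rwa [show b = b' by omega]

theorem eq_of_span_add_smul_eq {K V : Type*} [Field K] [AddCommGroup V] [Module K V] {v x : V}
    (h : LinearIndependent K ![v, x]) {t s : K}
    (hts : Submodule.span K {x + t • v} = Submodule.span K {x + s • v}) : t = s := by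
  obtain ⟨c, hc⟩ := Submodule.mem_span_singleton.1
    (hts ▸ Submodule.mem_span_singleton_self (x + t • v))
  obtain ⟨h1, h2⟩ := LinearIndependent.pair_iff.1 h (c * s - t) (c - 1) (by
    rw [sub_smul, sub_smul, mul_smul, one_smul, ← sub_eq_zero.2 hc, smul_add]
    abel)
  linear_combination -h1 + s * h2

/-- The common degree, after removing common factors, of a family of forms which maps lines
birationally to lines is one. -/
theorem degree_eq_one_of_lines_to_lines {n : ℕ} (hn : 0 < n)
    {F : Fin (n + 1) → MvPolynomial (Fin (n + 1)) ℂ}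
    {p : MvPolynomial (Fin (n + 1)) ℂ} {F' : Fin (n + 1) → MvPolynomial (Fin (n + 1)) ℂ}
    {a b : ℕ} (hpF : ∀ i, F i = p * F' i) (ha : p.IsHomogeneous a)
    (hb : ∀ i, (F' i).IsHomogeneous b) (hg : ∀ g, (∀ i, g ∣ F' i) → IsUnit g)
    {i₀ : Fin (n + 1)} (hi₀ : F i₀ ≠ 0)
    (Fe : (Fin (n + 1) → ℂ) → (Fin (n + 1) → ℂ))
    (hFe : ∀ x i, Fe x i = MvPolynomial.eval x (F i))
    (hline : ∀ L : Submodule ℂ (Fin (n + 1) → ℂ), Module.finrank ℂ L = 2 →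
      (∃ x ∈ L, Fe x ≠ 0) →
      ∃ L' : Submodule ℂ (Fin (n + 1) → ℂ), Module.finrank ℂ L' = 2 ∧
        (∀ x ∈ L, Fe x ∈ L') ∧
        ∃ S : Set (Submodule ℂ (Fin (n + 1) → ℂ)), S.Finite ∧
          ∀ x ∈ L, ∀ y ∈ L, Fe x ≠ 0 → Fe y ≠ 0 →
            Submodule.span ℂ {x} ∉ S → Submodule.span ℂ {y} ∉ S →
            Submodule.span ℂ {Fe x} = Submodule.span ℂ {Fe y} →
            Submodule.span ℂ {x} = Submodule.span ℂ {y}) :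
    b = 1 := by
  obtain ⟨v, hv⟩ := MvPolynomial.exists_eval_ne_zero
    (mul_ne_zero hi₀ (MvPolynomial.X_ne_zero (0 : Fin (n + 1))))
  rw [hpF, map_mul, map_mul, MvPolynomial.eval_X] at hv
  have hv0 : v ≠ 0 := fun h => right_ne_zero_of_mul hv (by simp [h])
  have hpv := left_ne_zero_of_mul (left_ne_zero_of_mul hv)
  have hF'v := right_ne_zero_of_mul (left_ne_zero_of_mul hv)
  obtain ⟨x, hvx, hx⟩ := MvPolynomial.exists_line_forall_exists_eval_ne_zero hn F' hg hv0
  obtain ⟨q, hq⟩ := MvPolynomial.exists_polynomial_eval_line p x v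
  choose f hf using fun i => MvPolynomial.exists_polynomial_eval_line (F' i) x v
  have hq0 : q ≠ 0 := by
    rintro rfl
    have := (ha.le_one_of_eval_line hpv (x := x) (a := 0) (b := 0) fun t => by
      rw [← hq]; simp).2
    simp at this
  have hFef : ∀ t : ℂ, Fe (x + t • v) = q.eval t • fun i => (f i).eval t := by
    intro t
    ext i
    simp [hFe, hpF, hq, hf]
  have hf0 : ∀ t, (fun i => (f i).eval t) ≠ 0 := fun t h => by
    obtain ⟨i, hi⟩ := hx t
    exact hi (hf i t ▸ congrFun h i)
  have hFe0 : ∀ t, q.eval t ≠ 0 → Fe (x + t • v) ≠ 0 := fun t ht => by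
    rw [hFef]
    exact smul_ne_zero ht (hf0 t)
  set L := Submodule.span ℂ (Set.range ![v, x])
  have hmemL : ∀ t : ℂ, x + t • v ∈ L := fun t =>
    add_mem (Submodule.subset_span ⟨1, rfl⟩)
      (Submodule.smul_mem _ _ (Submodule.subset_span ⟨0, rfl⟩))
  obtain ⟨t₀, ht₀⟩ := (Polynomial.finite_setOfPred_isRoot hq0).infinite_compl.nonempty
  obtain ⟨L', hL', hLL', S, hS, hSinj⟩ := hline L (by simpa using finrank_span_eq_card hvx)
    ⟨_, hmemL t₀, hFe0 t₀ ht₀⟩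
  set T : Set ℂ := {t | q.IsRoot t} ∪ {t | Submodule.span ℂ {x + t • v} ∈ S}
  have hT : T.Finite := (Polynomial.finite_setOfPred_isRoot hq0).union
    (hS.preimage fun t _ s _ hts => eq_of_span_add_smul_eq hvx hts)
  have hspan : ∀ t, q.eval t ≠ 0 →
      Submodule.span ℂ {Fe (x + t • v)} = Submodule.span ℂ {fun i => (f i).eval t} :=
    fun t ht => by rw [hFef, Submodule.span_singleton_smul_eq (IsUnit.mk0 _ ht)]
  have hinj : ∀ t ∉ T, ∀ s ∉ T, Submodule.span ℂ {fun i => (f i).eval t} =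
      Submodule.span ℂ {fun i => (f i).eval s} → t = s := by
    intro t ht s hs hts
    simp only [T, Set.mem_union, not_or] at ht hs
    refine eq_of_span_add_smul_eq hvx (hSinj _ (hmemL t) _ (hmemL s) (hFe0 t ht.1) (hFe0 s hs.1)
      ht.2 hs.2 ?_)
    rw [hspan t ht.1, hspan s hs.1, hts]
  have hdeg := Polynomial.natDegree_le_one_of_mem_plane (fun t => by simpa [hf] using hx t) hL' hT
    (fun t ht => by
      simp only [T, Set.mem_union, not_or] at ht
      have := hLL' _ (hmemL t)
      rw [hFef] at this
      exact (Submodule.smul_mem_iff _ ht.1).1 this) hinj i₀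
  have hb1 : b ≤ 1 := by
    obtain ⟨c, e, hce⟩ := Polynomial.exists_eq_X_add_C_of_natDegree_le_one hdeg
    refine ((hb i₀).le_one_of_eval_line hF'v (x := x) (a := e) (b := c) fun t => ?_).1
    rw [← hf, hce]
    simp
    ring
  have hb0 : b ≠ 0 := by
    rintro rfl
    have hconst : ∀ i y, MvPolynomial.eval y (F' i) = MvPolynomial.eval 0 (F' i) := fun i y => by
      simpa using ((hb i).eval_smul 0 y).symm
    obtain ⟨t, ht, s, hs, hts⟩ := hT.infinite_compl.nontrivial
    refine hts (hinj t ht s hs ?_)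
    simp only [hf, hconst]
  omega

/-- A birational map `H : ℙ^n ⇢ ℙ^n` (`n ≥ 2`), given in homogeneous coordinates by
homogeneous polynomials `F` of a common degree with a rational inverse, which maps every
projective line (not contained in its indeterminacy locus) birationally onto a projective
line, is a biholomorphism of `ℙ^n`, i.e. is induced by a linear automorphism of `ℂ^{n+1}`
(an element of `PGL(n+1, ℂ)`). -/
theorem stmt7 (n : ℕ) (hn : 2 ≤ n) (d : ℕ)
    (F : Fin (n + 1) → MvPolynomial (Fin (n + 1)) ℂ)
    (hF : ∀ i, (F i).IsHomogeneous d)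
    (Fe : (Fin (n + 1) → ℂ) → (Fin (n + 1) → ℂ))
    (hFe : ∀ x i, Fe x i = MvPolynomial.eval x (F i))
    -- `H` is birational: it admits a rational inverse defined off a hypersurface
    (hbir : ∃ (e : ℕ) (G : Fin (n + 1) → MvPolynomial (Fin (n + 1)) ℂ)
        (h : MvPolynomial (Fin (n + 1)) ℂ),
      (∀ i, (G i).IsHomogeneous e) ∧ h ≠ 0 ∧
      ∀ x : Fin (n + 1) → ℂ, MvPolynomial.eval x h ≠ 0 →
        ∃ c : ℂ, c ≠ 0 ∧ (fun i => MvPolynomial.eval (Fe x) (G i)) = c • x)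
    -- `H` maps every line (on which it is defined somewhere) birationally onto a line
    (hline : ∀ L : Submodule ℂ (Fin (n + 1) → ℂ), Module.finrank ℂ L = 2 →
      (∃ x ∈ L, Fe x ≠ 0) →
      ∃ L' : Submodule ℂ (Fin (n + 1) → ℂ), Module.finrank ℂ L' = 2 ∧
        (∀ x ∈ L, Fe x ∈ L') ∧
        ∃ S : Set (Submodule ℂ (Fin (n + 1) → ℂ)), S.Finite ∧
          ∀ x ∈ L, ∀ y ∈ L, Fe x ≠ 0 → Fe y ≠ 0 →
            Submodule.span ℂ {x} ∉ S → Submodule.span ℂ {y} ∉ S →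
            Submodule.span ℂ {Fe x} = Submodule.span ℂ {Fe y} →
            Submodule.span ℂ {x} = Submodule.span ℂ {y}) :
    ∃ A : (Fin (n + 1) → ℂ) ≃ₗ[ℂ] (Fin (n + 1) → ℂ),
      ∀ x : Fin (n + 1) → ℂ, Fe x ≠ 0 → ∃ c : ℂ, c ≠ 0 ∧ Fe x = c • A x := by
  have hn0 : 0 < n := by omega
  obtain ⟨e, G, h, hG, hh, hGF⟩ := hbir
  obtain ⟨i₀, hi₀⟩ : ∃ i, F i ≠ 0 := by
    by_contra! h0
    have hFe0 : ∀ x, Fe x = 0 := fun x => funext fun i => by simp [hFe, h0]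
    obtain ⟨x, hx, hxw⟩ := MvPolynomial.exists_eval_ne_zero_and_ne_smul hn0 hh
      (fun i => MvPolynomial.eval 0 (G i))
    obtain ⟨c, hc, hcx⟩ := hGF x hx
    rw [hFe0] at hcx
    exact hxw c⁻¹ (by rw [hcx, inv_smul_smul₀ hc])
  obtain ⟨p, F', a, b, hpF, ha, hb, hg⟩ := MvPolynomial.exists_isHomogeneous_eq_mul hF hi₀
  obtain rfl : b = 1 := degree_eq_one_of_lines_to_lines hn0 hpF ha hb hg hi₀ Fe hFe hline
  let A : (Fin (n + 1) → ℂ) →ₗ[ℂ] (Fin (n + 1) → ℂ) :=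
    LinearMap.pi fun i => (hb i).isLinearMap_eval.mk'
  have hFeA : ∀ x, Fe x = MvPolynomial.eval x p • A x := fun x => funext fun i => by
    simp [hFe, hpF, A]
  have hGA : ∀ x, (fun i => MvPolynomial.eval (Fe x) (G i)) =
      MvPolynomial.eval x p ^ e • fun i => MvPolynomial.eval (A x) (G i) := fun x =>
    funext fun i => by rw [hFeA, (hG i).eval_smul]; rfl
  have hA : Function.Injective A := by
    rw [injective_iff_map_eq_zero]
    intro w hw
    by_contra hw0
    obtain ⟨x, hx, hxw⟩ := MvPolynomial.exists_eval_ne_zero_and_ne_smul hn0 hh w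
    obtain ⟨g, hg⟩ := MvPolynomial.exists_polynomial_eval_line h x w
    have hg0 : g ≠ 0 := fun h0 => hx (by simpa [h0] using (hg 0).symm)
    obtain ⟨t, ht⟩ := ((Polynomial.finite_setOfPred_isRoot hg0).union
      (Set.finite_singleton 0)).infinite_compl.nonempty
    simp only [Set.mem_compl_iff, Set.mem_union, not_or, Set.mem_singleton_iff] at ht
    obtain ⟨hgt, ht0⟩ := ht
    obtain ⟨c, hc, hcx⟩ := hGF x hx
    obtain ⟨c', hc', hcx'⟩ := hGF (x + t • w) (by rw [← hg]; exact hgt)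
    rw [hGA] at hcx hcx'
    rw [map_add, map_smul, hw, smul_zero, add_zero] at hcx'
    set k := fun i => MvPolynomial.eval (A x) (G i)
    set m := MvPolynomial.eval x p ^ e
    set m' := MvPolynomial.eval (x + t • w) p ^ e
    have hlin : (m * c' * t) • w = (m' * c - m * c') • x := by
      ext i
      have h1 := congrFun hcx i
      have h2 := congrFun hcx' i
      simp only [Pi.smul_apply, Pi.add_apply, smul_eq_mul] at h1 h2 ⊢
      linear_combination m' * h1 - m * h2
    have hm : m ≠ 0 := fun h0 => by
      rw [h0, zero_smul, eq_comm, smul_eq_zero] at hcx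
      exact hxw 0 (by rw [hcx.resolve_left hc, zero_smul])
    have hne : m' * c - m * c' ≠ 0 := fun h0 => by
      rw [h0, zero_smul] at hlin
      exact smul_ne_zero (mul_ne_zero (mul_ne_zero hm hc') ht0) hw0 hlin
    refine hxw ((m' * c - m * c')⁻¹ * (m * c' * t)) ?_
    rw [mul_smul, hlin, inv_smul_smul₀ hne]
  refine ⟨LinearEquiv.ofInjectiveEndo A hA, fun x hx => ⟨MvPolynomial.eval x p, ?_, hFeA x⟩⟩
  exact fun h0 => hx (by rw [hFeA, h0, zero_smul])
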